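/- Let n be an integer with 8 ≤ n ≤ 13. Then there is no equiangular family of 28 lines in a Euclidean space whose linear span has dimension n; equivalently, there do not exist unit vectors u₁, …, u₂₈ spanning an n-dimensional subspace, pairwise non-proportional, such that |⟨u_i, u_j⟩| is a constant α for all i ≠ j. -/

import Mathlib

open scoped InnerProductSpace

open Polynomial in
/-- Over a perfect field every polynomial is divisible by the minimal polynomial of a root,
to the power of the multiplicity of that root. -/
theorem minpoly_pow_rootMultiplicity_dvd {K L : Type*} [Field K] [Field L] [Algebra K L]
    [PerfectField K] {β : L} (hβ : IsIntegral K β) (k : ℕ) (f : K[X]) (hf : f ≠ 0)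
    (hk : k ≤ (f.map (algebraMap K L)).rootMultiplicity β) : minpoly K β ^ k ∣ f := by
  induction k generalizing f with
  | zero => simp
  | succ k ih =>
    have hf' : f.map (algebraMap K L) ≠ 0 :=
      (Polynomial.map_ne_zero_iff (algebraMap K L).injective).2 hf
    have hroot : aeval β f = 0 := by
      have h := (rootMultiplicity_pos hf' (x := β)).1 (by omega)
      rwa [IsRoot.def, eval_map_algebraMap] at h
    obtain ⟨g, rfl⟩ := minpoly.dvd K β hroot
    have hg : g ≠ 0 := right_ne_zero_of_mul hf
    have hsep : ((minpoly K β).map (algebraMap K L)).Separable :=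
      (PerfectField.separable_of_irreducible (minpoly.irreducible hβ)).map
    have h1 := rootMultiplicity_le_one_of_separable hsep β
    rw [Polynomial.map_mul] at hk hf'
    rw [rootMultiplicity_mul hf'] at hk
    rw [pow_succ']
    exact mul_dvd_mul_left _ (ih g hg (by omega))

open Polynomial in
/-- A real root of a monic integer polynomial whose multiplicity exceeds half the degree
is an integer. -/
theorem exists_int_eq_of_natDegree_lt_two_mul_rootMultiplicity {f : ℤ[X]} (hf : f.Monic) {β : ℝ}
    (h : f.natDegree < 2 * (f.map (algebraMap ℤ ℝ)).rootMultiplicity β) :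
    ∃ b : ℤ, β = b := by
  have hmap : (f.map (algebraMap ℤ ℚ)).map (algebraMap ℚ ℝ) = f.map (algebraMap ℤ ℝ) := by
    rw [Polynomial.map_map, ← IsScalarTower.algebraMap_eq]
  have hroot : IsIntegral ℤ β := by
    refine ⟨f, hf, ?_⟩
    have h := (rootMultiplicity_pos (hf.map (algebraMap ℤ ℝ)).ne_zero (x := β)).1 (by omega)
    rwa [IsRoot.def, eval_map] at h
  have hQ : IsIntegral ℚ β := hroot.tower_top
  have hfQ : f.map (algebraMap ℤ ℚ) ≠ 0 := (hf.map _).ne_zero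
  have hdvd := minpoly_pow_rootMultiplicity_dvd hQ _ _ hfQ le_rfl
  have hdeg := natDegree_le_of_dvd hdvd hfQ
  rw [natDegree_pow, hmap, hf.natDegree_map] at hdeg
  have hpos := minpoly.natDegree_pos hQ
  have hone : (minpoly ℚ β).natDegree = 1 := by
    by_contra hne
    have : 2 ≤ (minpoly ℚ β).natDegree := by omega
    nlinarith
  obtain ⟨q, rfl⟩ := minpoly.natDegree_eq_one_iff.1 hone
  have hq : IsIntegral ℤ q := (isIntegral_algebraMap_iff (algebraMap ℚ ℝ).injective).1 hroot
  obtain ⟨b, rfl⟩ := IsIntegrallyClosed.isIntegral_iff.1 hq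
  exact ⟨b, by simp⟩

/-- An integer matrix of even order with zero diagonal and odd off-diagonal entries has no even
integer eigenvalue. -/
theorem eval_charpoly_ne_zero_of_even {ι : Type*} [Fintype ι] [DecidableEq ι]
    (hι : Even (Fintype.card ι)) (S : Matrix ι ι ℤ) (hdiag : ∀ i, S i i = 0)
    (hodd : ∀ i j, i ≠ j → Odd (S i j)) {b : ℤ} (hb : Even b) : S.charpoly.eval b ≠ 0 := by
  intro h0
  rw [Matrix.eval_charpoly] at h0
  set T : Matrix ι ι (ZMod 2) := (Matrix.scalar ι b - S).map (Int.castRingHom (ZMod 2)) with hT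
  have hdet : T.det = 0 := by
    rw [hT, ← RingHom.mapMatrix_apply, ← RingHom.map_det, h0, map_zero]
  have h2 : (2 : ZMod 2) = 0 := rfl
  have hb2 : (b : ZMod 2) = 0 :=
    (ZMod.intCast_zmod_eq_zero_iff_dvd b 2).2 (by exact_mod_cast hb.two_dvd)
  have hentry : ∀ i j, T i j = if i = j then 0 else 1 := by
    intro i j
    rw [hT, Matrix.map_apply, Matrix.sub_apply, Matrix.scalar_apply]
    by_cases hij : i = j
    · subst hij
      rw [Matrix.diagonal_apply_eq, hdiag]
      simp [hb2]
    · obtain ⟨k, hk⟩ := hodd i j hij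
      rw [Matrix.diagonal_apply_ne _ hij, hk]
      simp only [if_neg hij, eq_intCast]
      push_cast
      linear_combination (-(k : ZMod 2) - 1) * h2
  have hsq : T * T = 1 := by
    have hTJ : T = Matrix.of (fun _ _ => 1) - 1 := by
      ext i j
      rw [hentry, Matrix.sub_apply, Matrix.one_apply, Matrix.of_apply]
      split_ifs <;> simp
    have hc : ((Fintype.card ι : ℕ) : ZMod 2) = 0 := (ZMod.natCast_eq_zero_iff _ 2).2 hι.two_dvd
    have hJ : (Matrix.of (fun _ _ => 1) : Matrix ι ι (ZMod 2)) * Matrix.of (fun _ _ => 1) = 0 := by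
      ext i j
      simp [Matrix.mul_apply, hc]
    rw [hTJ, sub_mul, mul_sub, hJ, mul_one, one_mul]
    ext i j
    simp only [Matrix.sub_apply, Matrix.of_apply, Matrix.zero_apply]
    linear_combination (-1 : ZMod 2) * h2
  have := congrArg Matrix.det hsq
  rw [Matrix.det_mul, hdet, Matrix.det_one] at this
  simp at this

/-- The relative (Welch) bound for unit vectors. -/
theorem card_sq_le_finrank_mul_sum_inner_sq {F : Type*} [NormedAddCommGroup F]
    [InnerProductSpace ℝ F] [FiniteDimensional ℝ F] {ι : Type*} [Fintype ι] (v : ι → F)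
    (hv : ∀ i, ‖v i‖ = 1) :
    (Fintype.card ι : ℝ) ^ 2 ≤ Module.finrank ℝ F * ∑ i, ∑ j, ⟪v i, v j⟫_ℝ ^ 2 := by
  set e := stdOrthonormalBasis ℝ F
  set a : Fin (Module.finrank ℝ F) → ι → ℝ := fun k i => ⟪v i, e k⟫_ℝ with ha
  have hin : ∀ i j, ⟪v i, v j⟫_ℝ = ∑ k, a k i * a k j := by
    intro i j
    rw [← e.sum_inner_mul_inner (v i) (v j)]
    exact Finset.sum_congr rfl fun k _ => by simp only [ha, real_inner_comm]
  have hcard : (Fintype.card ι : ℝ) = ∑ k, ∑ i, a k i ^ 2 := by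
    rw [Finset.sum_comm]
    have : ∀ i, ∑ k, a k i ^ 2 = 1 := fun i => by
      have h := hin i i
      rw [real_inner_self_eq_norm_sq, hv i] at h
      simpa [sq] using h.symm
    simp [this]
  have hsum : ∑ i, ∑ j, ⟪v i, v j⟫_ℝ ^ 2 = ∑ k, ∑ l, (∑ i, a k i * a l i) ^ 2 := by
    simp_rw [hin, sq, Finset.sum_mul_sum]
    calc _ = ∑ i, ∑ k, ∑ j, ∑ l, a k i * a k j * (a l i * a l j) :=
          Finset.sum_congr rfl fun i _ => Finset.sum_comm
      _ = ∑ k, ∑ i, ∑ l, ∑ j, a k i * a k j * (a l i * a l j) := by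
          rw [Finset.sum_comm]
          exact Finset.sum_congr rfl fun k _ => Finset.sum_congr rfl fun i _ => Finset.sum_comm
      _ = _ := by
          refine Finset.sum_congr rfl fun k _ => ?_
          rw [Finset.sum_comm]
          refine Finset.sum_congr rfl fun l _ => Finset.sum_congr rfl fun i _ =>
            Finset.sum_congr rfl fun j _ => by ring
  rw [hsum, hcard]
  calc (∑ k, ∑ i, a k i ^ 2) ^ 2
      ≤ (Finset.univ : Finset (Fin (Module.finrank ℝ F))).card * ∑ k, (∑ i, a k i ^ 2) ^ 2 :=
        sq_sum_le_card_mul_sum_sq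
    _ ≤ _ := by
        rw [Finset.card_univ, Fintype.card_fin]
        refine mul_le_mul_of_nonneg_left (Finset.sum_le_sum fun k _ => ?_) (Nat.cast_nonneg _)
        have := Finset.single_le_sum (f := fun l => (∑ i, a k i * a l i) ^ 2)
          (fun l _ => sq_nonneg _) (Finset.mem_univ k)
        simpa [sq] using this

/-- If `I + α S` is the Gram matrix of a family of vectors, the multiplicity of the eigenvalue
`-1/α` of `S` is at least the corank of the family. -/
theorem card_le_finrank_span_add_rootMultiplicity {E : Type*} [NormedAddCommGroup E]
    [InnerProductSpace ℝ E] {ι : Type*} [Fintype ι] [DecidableEq ι] (u : ι → E)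
    (S : Matrix ι ι ℤ) {α : ℝ} (hα : α ≠ 0)
    (hS : ∀ i j, ⟪u i, u j⟫_ℝ = (if i = j then 1 else 0) + α * S i j) :
    Fintype.card ι ≤ Module.finrank ℝ (Submodule.span ℝ (Set.range u)) +
      (S.charpoly.map (algebraMap ℤ ℝ)).rootMultiplicity (-1 / α) := by
  set A : Matrix ι ι ℝ := S.map (algebraMap ℤ ℝ) with hA
  have hchar : S.charpoly.map (algebraMap ℤ ℝ) = (Matrix.toLin' A).charpoly := by
    rw [hA, ← Matrix.charpoly_map, Matrix.charpoly_toLin']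
  have hker : LinearMap.ker (Fintype.linearCombination ℝ u) ≤
      Module.End.eigenspace (Matrix.toLin' A) (-1 / α) := by
    intro c hc
    rw [LinearMap.mem_ker, Fintype.linearCombination_apply] at hc
    rw [Module.End.mem_eigenspace_iff, Matrix.toLin'_apply]
    ext j
    have h := congrArg (fun x => ⟪u j, x⟫_ℝ) hc
    simp only [inner_sum, inner_smul_right, inner_zero_right, hS, mul_add, Finset.sum_add_distrib,
      mul_ite, mul_one, mul_zero, Finset.sum_ite_eq, Finset.mem_univ, if_true] at h
    have h' : (A.mulVec c) j * α = -c j := by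
      simp only [Matrix.mulVec, dotProduct, hA, Matrix.map_apply, eq_intCast, Finset.sum_mul]
      rw [eq_neg_iff_add_eq_zero, add_comm, ← h]
      congr 1
      exact Finset.sum_congr rfl fun i _ => by ring
    simp only [Pi.smul_apply, smul_eq_mul]
    field_simp
    linarith
  have h1 := LinearMap.finrank_range_add_finrank_ker (Fintype.linearCombination ℝ u)
  rw [Fintype.range_linearCombination, Module.finrank_fintype_fun_eq_card] at h1
  have h2 := Submodule.finrank_mono hker
  have h3 := LinearMap.finrank_eigenspace_le (Matrix.toLin' A) (-1 / α)
  rw [hchar]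
  omega

/-- Twenty-eight equiangular lines of rank at most `13` have common angle `arccos (1/3)`. -/
theorem equiangular_constant_eq_third {E : Type*} [NormedAddCommGroup E] [InnerProductSpace ℝ E]
    [FiniteDimensional ℝ E] (u : Fin 28 → E) {α : ℝ} (hu : ∀ i, ‖u i‖ = 1)
    (hne : ∀ i j, i ≠ j → u i ≠ u j ∧ u i ≠ -u j) (hα : ∀ i j, i ≠ j → |⟪u i, u j⟫_ℝ| = α)
    (hrank : Module.finrank ℝ (Submodule.span ℝ (Set.range u)) ≤ 13) : α = 1 / 3 := by
  have hsq : ∀ i j, i ≠ j → ⟪u i, u j⟫_ℝ ^ 2 = α ^ 2 := fun i j hij => by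
    rw [← hα i j hij, sq_abs]
  have hα0 : 0 ≤ α := hα 0 1 (by decide) ▸ abs_nonneg _
  have hα1 : α ≠ 1 := by
    rintro rfl
    rcases (abs_eq zero_le_one).1 (hα 0 1 (by decide)) with h | h
    · exact (hne 0 1 (by decide)).1 ((inner_eq_one_iff_of_norm_eq_one (hu 0) (hu 1)).1 h)
    · exact (hne 0 1 (by decide)).2 ((inner_eq_neg_one_iff_of_norm_eq_one (hu 0) (hu 1)).1 h)
  have hwelch : 1 / 25 < α ^ 2 := by
    let v : Fin 28 → Submodule.span ℝ (Set.range u) := fun i =>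
      ⟨u i, Submodule.subset_span (Set.mem_range_self i)⟩
    have h := card_sq_le_finrank_mul_sum_inner_sq v (fun i => hu i)
    have hrow : ∀ i, ∑ j, ⟪v i, v j⟫_ℝ ^ 2 = 1 + 27 * α ^ 2 := fun i => by
      rw [← Finset.add_sum_erase _ _ (Finset.mem_univ i),
        Finset.sum_congr rfl (f := fun j => ⟪v i, v j⟫_ℝ ^ 2) (g := fun _ => α ^ 2) fun j hj =>
          hsq i j (Finset.ne_of_mem_erase hj).symm]
      simp [v, hu, Finset.card_erase_of_mem]
    simp only [hrow, Finset.sum_const, Finset.card_univ, Fintype.card_fin, nsmul_eq_mul] at h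
    have hr : (Module.finrank ℝ (Submodule.span ℝ (Set.range u)) : ℝ) ≤ 13 := by
      exact_mod_cast hrank
    push_cast at h
    nlinarith [mul_le_mul_of_nonneg_right hr (show 0 ≤ 28 * (1 + 27 * α ^ 2) by positivity)]
  have hαpos : 0 < α := lt_of_le_of_ne hα0 fun h => by
    rw [← h] at hwelch
    norm_num at hwelch
  let S : Matrix (Fin 28) (Fin 28) ℤ := fun i j =>
    if i = j then 0 else if 0 ≤ ⟪u i, u j⟫_ℝ then 1 else -1
  have hS : ∀ i j, ⟪u i, u j⟫_ℝ = (if i = j then 1 else 0) + α * S i j := by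
    intro i j
    by_cases hij : i = j
    · subst hij
      simp [S, hu]
    · have h := hα i j hij
      by_cases hs : 0 ≤ ⟪u i, u j⟫_ℝ
      · rw [abs_of_nonneg hs] at h
        simp [S, hij, h, hα0.not_gt]
      · rw [abs_of_neg (not_le.1 hs)] at h
        simp [S, hij, hs, ← h]
  have hmult := card_le_finrank_span_add_rootMultiplicity u S hαpos.ne' hS
  rw [Fintype.card_fin] at hmult
  obtain ⟨b, hb⟩ := exists_int_eq_of_natDegree_lt_two_mul_rootMultiplicity
    (Matrix.charpoly_monic S) (β := -1 / α) (by
      rw [Matrix.charpoly_natDegree_eq_dim, Fintype.card_fin]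
      omega)
  have hbodd : ¬ Even b := by
    intro hbe
    refine eval_charpoly_ne_zero_of_even (by decide) S (by simp [S]) (fun i j hij => ?_) hbe ?_
    · by_cases hs : 0 ≤ ⟪u i, u j⟫_ℝ <;> simp [S, hij, hs]
    · have hroot := (Polynomial.rootMultiplicity_pos
        ((Matrix.charpoly_monic S).map (algebraMap ℤ ℝ)).ne_zero (x := -1 / α)).1 (by omega)
      rw [hb, Polynomial.IsRoot.def, ← eq_intCast (algebraMap ℤ ℝ) b,
        Polynomial.eval_map_apply] at hroot
      simpa using hroot
  have hbα : (b : ℝ) * α = -1 := by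
    rw [← hb]
    field_simp
  have hb0 : b < 0 := by
    by_contra hb0
    have : (0 : ℝ) ≤ b := by exact_mod_cast not_lt.1 hb0
    nlinarith
  have hb5 : -5 < b := by
    by_contra hb5
    have h5 : (b : ℝ) ≤ -5 := by exact_mod_cast not_lt.1 hb5
    nlinarith
  have hcases : b = -4 ∨ b = -3 ∨ b = -2 ∨ b = -1 := by omega
  rcases hcases with rfl | rfl | rfl | rfl
  · exact absurd (by decide) hbodd
  · push_cast at hbα
    linarith
  · exact absurd (by decide) hbodd
  · push_cast at hbα
    exact absurd (by linarith) hα1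

/-- A finite set of unit vectors that are pairwise orthogonal or opposite is, up to sign,
an orthonormal set. -/
theorem exists_orthonormal_subset_of_inner_eq_zero_or_neg_one {E : Type*} [NormedAddCommGroup E]
    [InnerProductSpace ℝ E] (C : Finset E) (hunit : ∀ x ∈ C, ‖x‖ = 1)
    (hin : ∀ x ∈ C, ∀ y ∈ C, x ≠ y → ⟪x, y⟫_ℝ = 0 ∨ ⟪x, y⟫_ℝ = -1) :
    ∃ R ⊆ C, (∀ x ∈ R, ∀ y ∈ R, x ≠ y → ⟪x, y⟫_ℝ = 0) ∧ (∀ x ∈ C, x ∈ R ∨ -x ∈ R) ∧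
      C.card ≤ 2 * R.card := by
  classical
  suffices h : ∃ R ⊆ C, (∀ x ∈ R, ∀ y ∈ R, x ≠ y → ⟪x, y⟫_ℝ = 0) ∧ (∀ x ∈ C, x ∈ R ∨ -x ∈ R) by
    obtain ⟨R, hRC, hR, hC⟩ := h
    refine ⟨R, hRC, hR, hC, ?_⟩
    have hsub : C ⊆ R ∪ R.image Neg.neg := fun x hx => by
      rcases hC x hx with h | h
      · exact Finset.mem_union_left _ h
      · exact Finset.mem_union_right _ (Finset.mem_image.2 ⟨-x, h, neg_neg x⟩)
    have h1 := Finset.card_le_card hsub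
    have h2 := Finset.card_union_le R (R.image Neg.neg)
    have h3 := Finset.card_image_le (s := R) (f := Neg.neg)
    omega
  induction C using Finset.induction_on with
  | empty => exact ⟨∅, by simp⟩
  | insert c C hc ih =>
    obtain ⟨R, hRC, hR, hC⟩ := ih (fun x hx => hunit x (Finset.mem_insert_of_mem hx))
      (fun x hx y hy => hin x (Finset.mem_insert_of_mem hx) y (Finset.mem_insert_of_mem hy))
    have hcin : ∀ r ∈ R, ⟪c, r⟫_ℝ = 0 ∨ ⟪c, r⟫_ℝ = -1 := fun r hr =>
      hin c (Finset.mem_insert_self _ _) r (Finset.mem_insert_of_mem (hRC hr))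
        (fun h => hc (h ▸ hRC hr))
    by_cases hex : ∃ r ∈ R, ⟪c, r⟫_ℝ = -1
    · obtain ⟨r, hr, hcr⟩ := hex
      have hcr' : c = -r := (inner_eq_neg_one_iff_of_norm_eq_one
        (hunit c (Finset.mem_insert_self _ _)) (hunit r (Finset.mem_insert_of_mem (hRC hr)))).1 hcr
      refine ⟨R, hRC.trans (Finset.subset_insert _ _), hR, fun x hx => ?_⟩
      rcases Finset.mem_insert.1 hx with rfl | hx
      · right
        rwa [hcr', neg_neg]
      · exact hC x hx
    · push Not at hex
      have h0 : ∀ r ∈ R, ⟪c, r⟫_ℝ = 0 := fun r hr => (hcin r hr).resolve_right (hex r hr)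
      refine ⟨insert c R, Finset.insert_subset_insert _ hRC, fun x hx y hy hxy => ?_,
        fun x hx => ?_⟩
      · rcases Finset.mem_insert.1 hx with hxc | hx <;> rcases Finset.mem_insert.1 hy with hyc | hy
        · exact absurd (hxc.trans hyc.symm) hxy
        · exact hxc ▸ h0 y hy
        · rw [real_inner_comm, hyc]
          exact h0 x hx
        · exact hR x hx y hy hxy
      · rcases Finset.mem_insert.1 hx with rfl | hx
        · exact Or.inl (Finset.mem_insert_self _ _)
        · exact (hC x hx).imp (Finset.mem_insert_of_mem) (Finset.mem_insert_of_mem)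

/-- A unit vector making angle `π/3` or `2π/3` with each member of an orthonormal set forces that
set to have at most four elements, and lies in its span when there are exactly four. -/
theorem card_le_four_of_abs_inner_eq_half {E : Type*} [NormedAddCommGroup E]
    [InnerProductSpace ℝ E] (R : Finset E) (hunit : ∀ x ∈ R, ‖x‖ = 1)
    (horth : ∀ x ∈ R, ∀ y ∈ R, x ≠ y → ⟪x, y⟫_ℝ = 0) {v : E} (hv : ‖v‖ = 1)
    (hvR : ∀ x ∈ R, |⟪v, x⟫_ℝ| = 1 / 2) :
    R.card ≤ 4 ∧ (R.card = 4 → v ∈ Submodule.span ℝ (R : Set E)) := by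
  classical
  set w := ∑ x ∈ R, ⟪v, x⟫_ℝ • x with hw
  have hsq : ∀ x ∈ R, ⟪v, x⟫_ℝ * ⟪v, x⟫_ℝ = 1 / 4 := fun x hx => by
    rw [← abs_mul_abs_self, hvR x hx]
    norm_num
  have hvw : ⟪v, w⟫_ℝ = R.card / 4 := by
    simp only [hw, inner_sum, inner_smul_right]
    rw [Finset.sum_congr rfl hsq]
    simp [div_eq_mul_inv]
  have hww : ⟪w, w⟫_ℝ = R.card / 4 := by
    rw [← hvw]
    conv_lhs => rw [hw]
    conv_rhs => rw [hw]
    simp only [sum_inner, inner_sum, inner_smul_left, inner_smul_right]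
    refine Finset.sum_congr rfl fun x hx => ?_
    rw [Finset.sum_eq_single x]
    · simp [hunit x hx]
    · intro y hy hyx
      simp [horth y hy x hx hyx]
    · exact fun h => absurd hx h
  have hdiff : ‖v - w‖ ^ 2 = 1 - R.card / 4 := by
    rw [norm_sub_sq_real, hv, hvw, ← real_inner_self_eq_norm_sq w, hww]
    ring
  constructor
  · have := sq_nonneg ‖v - w‖
    rw [hdiff] at this
    have h4 : (R.card : ℝ) ≤ 4 := by linarith
    exact_mod_cast h4
  · intro h4
    rw [h4] at hdiff
    have h0 : v - w = 0 := by
      rw [← norm_eq_zero]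
      have : ‖v - w‖ ^ 2 = 0 := by rw [hdiff]; norm_num
      exact pow_eq_zero_iff (two_ne_zero) |>.1 this
    rw [sub_eq_zero.1 h0, hw]
    exact Submodule.sum_mem _ fun x hx => Submodule.smul_mem _ _ (Submodule.subset_span hx)

/-- Three sets of unit vectors, each consisting of pairwise orthogonal or opposite vectors, with
angles `π/3` or `2π/3` across distinct sets and at least `24` vectors in total: either one of the
sets contains `12` orthonormal vectors, or all vectors lie in a four-dimensional subspace. -/
theorem twelve_orthogonal_or_span_of_three_pillars {E : Type*} [NormedAddCommGroup E]
    [InnerProductSpace ℝ E] (C : Fin 3 → Finset E) (hunit : ∀ a, ∀ x ∈ C a, ‖x‖ = 1)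
    (hin : ∀ a, ∀ x ∈ C a, ∀ y ∈ C a, x ≠ y → ⟪x, y⟫_ℝ = 0 ∨ ⟪x, y⟫_ℝ = -1)
    (hcross : ∀ a b, a ≠ b → ∀ x ∈ C a, ∀ y ∈ C b, |⟪x, y⟫_ℝ| = 1 / 2)
    (hcard : 24 ≤ ∑ a, (C a).card) :
    (∃ a, ∃ R ⊆ C a, (∀ x ∈ R, ∀ y ∈ R, x ≠ y → ⟪x, y⟫_ℝ = 0) ∧ 12 ≤ R.card) ∨
      ∃ R : Finset E, R.card = 4 ∧ ∀ a, ∀ x ∈ C a, x ∈ Submodule.span ℝ (R : Set E) := by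
  choose R hRC hR hCR hRcard using fun a =>
    exists_orthonormal_subset_of_inner_eq_zero_or_neg_one (C a) (hunit a) (hin a)
  have hfour : ∀ a b, a ≠ b → ∀ v ∈ C b,
      (R a).card ≤ 4 ∧ ((R a).card = 4 → v ∈ Submodule.span ℝ (R a : Set E)) :=
    fun a b hab v hv => card_le_four_of_abs_inner_eq_half (R a)
      (fun x hx => hunit a x (hRC a hx)) (hR a) (hunit b v hv)
      (fun x hx => hcross b a hab.symm v hv x (hRC a hx))
  have hle : ∀ a b, a ≠ b → 0 < (C b).card → (C a).card ≤ 8 := fun a b hab hb => by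
    obtain ⟨v, hv⟩ := Finset.card_pos.1 hb
    have := (hfour a b hab v hv).1
    have := hRcard a
    omega
  rw [Fin.sum_univ_three] at hcard
  by_cases hbig : ∃ a, 24 ≤ (C a).card
  · obtain ⟨a, ha⟩ := hbig
    exact Or.inl ⟨a, R a, hRC a, hR a, by have := hRcard a; omega⟩
  · right
    push Not at hbig
    have b0 := hbig 0
    have b1 := hbig 1
    have b2 := hbig 2
    have h01 := hle 0 1 (by decide)
    have h02 := hle 0 2 (by decide)
    have h10 := hle 1 0 (by decide)
    have h12 := hle 1 2 (by decide)
    have h20 := hle 2 0 (by decide)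
    have h21 := hle 2 1 (by decide)
    have hc0 : (C 0).card = 8 := by omega
    have hc1 : 0 < (C 1).card := by omega
    obtain ⟨v, hv⟩ := Finset.card_pos.1 hc1
    have hR4 : (R 0).card = 4 := by
      have := (hfour 0 1 (by decide) v hv).1
      have := hRcard 0
      omega
    refine ⟨R 0, hR4, fun a x hx => ?_⟩
    by_cases ha : a = 0
    · subst ha
      rcases hCR 0 x hx with h | h
      · exact Submodule.subset_span h
      · exact (Submodule.neg_mem_iff _).1 (Submodule.subset_span h)
    · exact (hfour 0 a (Ne.symm ha) x hx).2 hR4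

/-- A linearly dependent equiangular family with angle `arccos (1/3)` contains three vectors
whose pairwise inner products have negative product. -/
theorem exists_negative_triple {E : Type*} [NormedAddCommGroup E] [InnerProductSpace ℝ E]
    [FiniteDimensional ℝ E] {ι : Type*} [Fintype ι] [Nonempty ι] (u : ι → E)
    (hu : ∀ i, ‖u i‖ = 1) (hα : ∀ i j, i ≠ j → |⟪u i, u j⟫_ℝ| = 1 / 3)
    (hrank : Module.finrank ℝ (Submodule.span ℝ (Set.range u)) < Fintype.card ι) :
    ∃ i j k, i ≠ j ∧ i ≠ k ∧ j ≠ k ∧ ⟪u i, u j⟫_ℝ * ⟪u i, u k⟫_ℝ * ⟪u j, u k⟫_ℝ < 0 := by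
  classical
  by_contra! hcon
  obtain ⟨z⟩ := ‹Nonempty ι›
  have hval : ∀ i j, i ≠ j → ⟪u i, u j⟫_ℝ = 1 / 3 ∨ ⟪u i, u j⟫_ℝ = -(1 / 3) := fun i j hij =>
    (abs_eq (by norm_num)).1 (hα i j hij)
  let s : ι → ℝ := fun i => if i = z then 1 else 3 * ⟪u z, u i⟫_ℝ
  let w : ι → E := fun i => s i • u i
  have hself : ∀ i, ⟪w i, w i⟫_ℝ = 1 := by
    intro i
    simp only [w, s, inner_smul_left, inner_smul_right, real_inner_self_eq_norm_sq, hu]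
    by_cases hi : i = z
    · simp [hi]
    · rcases hval z i (Ne.symm hi) with h | h <;> simp [hi, h]
  have hoff : ∀ i j, i ≠ j → ⟪w i, w j⟫_ℝ = 1 / 3 := by
    intro i j hij
    simp only [w, s, inner_smul_left, inner_smul_right]
    by_cases hi : i = z
    · subst hi
      rcases hval i j hij with h | h <;> simp [hij.symm, h]
    · by_cases hj : j = z
      · subst hj
        rw [real_inner_comm (u j) (u i)]
        rcases hval j i hij.symm with h | h <;> simp [hij, h]
      · have ht := hcon z i j (Ne.symm hi) (Ne.symm hj) hij
        rcases hval z i (Ne.symm hi) with h1 | h1 <;> rcases hval z j (Ne.symm hj) with h2 | h2 <;>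
          rcases hval i j hij with h3 | h3 <;> rw [h1, h2, h3] at ht <;>
          first | linarith | norm_num [hi, hj, h1, h2, h3]
  have hli : LinearIndependent ℝ w := by
    rw [Fintype.linearIndependent_iff]
    intro g hg
    have hrow : ∀ j, 2 / 3 * g j + 1 / 3 * ∑ i, g i = 0 := by
      intro j
      have h := congrArg (fun x => ⟪w j, x⟫_ℝ) hg
      simp only [inner_sum, inner_smul_right, inner_zero_right] at h
      rw [← h, Finset.mul_sum, ← Finset.add_sum_erase _ _ (Finset.mem_univ j),
        ← Finset.add_sum_erase _ (fun i => g i * ⟪w j, w i⟫_ℝ) (Finset.mem_univ j), hself j,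
        Finset.sum_congr rfl (f := fun i => g i * ⟪w j, w i⟫_ℝ) (g := fun i => 1 / 3 * g i)
          fun i hi => by
          rw [hoff j i (Finset.ne_of_mem_erase hi).symm, mul_comm]]
      ring
    have htot : 2 / 3 * ∑ j, g j ^ 2 + 1 / 3 * (∑ i, g i) ^ 2 = 0 := by
      have h : ∑ j, g j * (2 / 3 * g j + 1 / 3 * ∑ i, g i) = 0 :=
        Finset.sum_eq_zero fun j _ => by rw [hrow j, mul_zero]
      rw [← h, sq (∑ i, g i), Finset.mul_sum, Finset.sum_mul, Finset.mul_sum,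
        ← Finset.sum_add_distrib]
      exact Finset.sum_congr rfl fun j _ => by ring
    intro i
    have h1 : g i ^ 2 ≤ ∑ j, g j ^ 2 :=
      Finset.single_le_sum (f := fun j => g j ^ 2) (fun j _ => sq_nonneg _) (Finset.mem_univ i)
    have h2 := sq_nonneg (∑ i, g i)
    have h3 : g i ^ 2 = 0 := le_antisymm (by linarith) (sq_nonneg _)
    exact pow_eq_zero_iff two_ne_zero |>.1 h3
  have hspan : Submodule.span ℝ (Set.range w) ≤ Submodule.span ℝ (Set.range u) := by
    rw [Submodule.span_le]
    rintro _ ⟨i, rfl⟩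
    exact Submodule.smul_mem _ _ (Submodule.subset_span (Set.mem_range_self i))
  have h1 := finrank_span_eq_card hli
  have h2 := Submodule.finrank_mono hspan
  omega

/-- Coordinates for the regular tetrahedron `p₁, p₂, p₃, p₄`, where `p₄ = -(p₁ + p₂ + p₃)`: its
span has an orthogonal basis `h` of vectors of squared norm `1/3`, and a unit vector at angle
`± arccos (1/3)` from `p₁, p₂, p₃` is `± p₄` or projects onto one of the `± h t`. -/
theorem exists_orthogonal_frame_of_tetrahedron {E : Type*} [NormedAddCommGroup E]
    [InnerProductSpace ℝ E] {p₁ p₂ p₃ : E} (h₁ : ‖p₁‖ = 1) (h₂ : ‖p₂‖ = 1) (h₃ : ‖p₃‖ = 1)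
    (h₁₂ : ⟪p₁, p₂⟫_ℝ = -(1 / 3)) (h₁₃ : ⟪p₁, p₃⟫_ℝ = -(1 / 3)) (h₂₃ : ⟪p₂, p₃⟫_ℝ = -(1 / 3)) :
    ∃ (h : Fin 3 → E) (p₄ : E), (∀ a b, ⟪h a, h b⟫_ℝ = if a = b then 1 / 3 else 0) ∧
      (∀ a, h a ∈ Submodule.span ℝ {p₁, p₂, p₃}) ∧
      (∀ p ∈ ({p₁, p₂, p₃, p₄} : Set E), p ∈ Submodule.span ℝ (Set.range h)) ∧
      ∀ x, ‖x‖ = 1 → |⟪x, p₁⟫_ℝ| = 1 / 3 → |⟪x, p₂⟫_ℝ| = 1 / 3 → |⟪x, p₃⟫_ℝ| = 1 / 3 →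
        (x = p₄ ∨ x = -p₄) ∨ ∃ (t : Fin 3) (s : ℝ), (s = 1 ∨ s = -1) ∧
          ∀ a, ⟪s • x, h a⟫_ℝ = if t = a then 1 / 3 else 0 := by
  have s₁ : ⟪p₁, p₁⟫_ℝ = 1 := by rw [real_inner_self_eq_norm_sq, h₁, one_pow]
  have s₂ : ⟪p₂, p₂⟫_ℝ = 1 := by rw [real_inner_self_eq_norm_sq, h₂, one_pow]
  have s₃ : ⟪p₃, p₃⟫_ℝ = 1 := by rw [real_inner_self_eq_norm_sq, h₃, one_pow]
  have h₂₁ : ⟪p₂, p₁⟫_ℝ = -(1 / 3) := by rw [real_inner_comm, h₁₂]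
  have h₃₁ : ⟪p₃, p₁⟫_ℝ = -(1 / 3) := by rw [real_inner_comm, h₁₃]
  have h₃₂ : ⟪p₃, p₂⟫_ℝ = -(1 / 3) := by rw [real_inner_comm, h₂₃]
  have d₀₁ : (0 : Fin 3) ≠ 1 := by decide
  have d₀₂ : (0 : Fin 3) ≠ 2 := by decide
  have d₁₂ : (1 : Fin 3) ≠ 2 := by decide
  let h : Fin 3 → E := ![(1 / 2 : ℝ) • (p₁ + p₂), (1 / 2 : ℝ) • (p₁ + p₃), (-1 / 2 : ℝ) • (p₂ + p₃)]
  have e₀ : h 0 = (1 / 2 : ℝ) • (p₁ + p₂) := rfl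
  have e₁ : h 1 = (1 / 2 : ℝ) • (p₁ + p₃) := rfl
  have e₂ : h 2 = (-1 / 2 : ℝ) • (p₂ + p₃) := rfl
  have hmem : ∀ a, h a ∈ Submodule.span ℝ (Set.range h) := fun a =>
    Submodule.subset_span (Set.mem_range_self a)
  refine ⟨h, -(p₁ + p₂ + p₃), ?_, ?_, ?_, ?_⟩
  · intro a b
    fin_cases a <;> fin_cases b <;>
      simp only [Fin.zero_eta, Fin.mk_one, Fin.reduceFinMk, e₀, e₁, e₂, inner_add_left,
        inner_add_right, real_inner_smul_left, real_inner_smul_right, s₁, s₂, s₃, h₁₂, h₁₃, h₂₃,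
        h₂₁, h₃₁, h₃₂] <;>
      norm_num [d₀₁, d₀₂, d₁₂, d₀₁.symm, d₀₂.symm, d₁₂.symm]
  · have m₁ : p₁ ∈ Submodule.span ℝ {p₁, p₂, p₃} := Submodule.subset_span (by simp)
    have m₂ : p₂ ∈ Submodule.span ℝ {p₁, p₂, p₃} := Submodule.subset_span (by simp)
    have m₃ : p₃ ∈ Submodule.span ℝ {p₁, p₂, p₃} := Submodule.subset_span (by simp)
    intro a
    fin_cases a
    · exact Submodule.smul_mem _ _ (Submodule.add_mem _ m₁ m₂)
    · exact Submodule.smul_mem _ _ (Submodule.add_mem _ m₁ m₃)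
    · exact Submodule.smul_mem _ _ (Submodule.add_mem _ m₂ m₃)
  · have m₁ : p₁ ∈ Submodule.span ℝ (Set.range h) := by
      have : p₁ = h 0 + h 1 + h 2 := by rw [e₀, e₁, e₂]; module
      rw [this]
      exact Submodule.add_mem _ (Submodule.add_mem _ (hmem 0) (hmem 1)) (hmem 2)
    have m₂ : p₂ ∈ Submodule.span ℝ (Set.range h) := by
      have : p₂ = h 0 - h 1 - h 2 := by rw [e₀, e₁, e₂]; module
      rw [this]
      exact Submodule.sub_mem _ (Submodule.sub_mem _ (hmem 0) (hmem 1)) (hmem 2)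
    have m₃ : p₃ ∈ Submodule.span ℝ (Set.range h) := by
      have : p₃ = h 1 - h 0 - h 2 := by rw [e₀, e₁, e₂]; module
      rw [this]
      exact Submodule.sub_mem _ (Submodule.sub_mem _ (hmem 1) (hmem 0)) (hmem 2)
    rintro p (rfl | rfl | rfl | rfl)
    · exact m₁
    · exact m₂
    · exact m₃
    · exact Submodule.neg_mem _ (Submodule.add_mem _ (Submodule.add_mem _ m₁ m₂) m₃)
  · intro x hx a₁ a₂ a₃
    have hp : ‖-(p₁ + p₂ + p₃)‖ = 1 := by
      have : ‖-(p₁ + p₂ + p₃)‖ ^ 2 = 1 := by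
        rw [← real_inner_self_eq_norm_sq]
        simp only [inner_neg_neg, inner_add_left, inner_add_right, s₁, s₂, s₃, h₁₂, h₁₃, h₂₃, h₂₁,
          h₃₁, h₃₂]
        norm_num
      exact (pow_eq_one_iff_of_nonneg (norm_nonneg _) two_ne_zero).1 this
    have hval : ⟪x, -(p₁ + p₂ + p₃)⟫_ℝ = -(⟪x, p₁⟫_ℝ + ⟪x, p₂⟫_ℝ + ⟪x, p₃⟫_ℝ) := by
      simp only [inner_neg_right, inner_add_right]
    have hframe : ∀ (t : Fin 3) (s : ℝ), (s = 1 ∨ s = -1) →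
        s * ((1 / 2) * (⟪x, p₁⟫_ℝ + ⟪x, p₂⟫_ℝ)) = (if t = 0 then 1 / 3 else 0) →
        s * ((1 / 2) * (⟪x, p₁⟫_ℝ + ⟪x, p₃⟫_ℝ)) = (if t = 1 then 1 / 3 else 0) →
        s * ((-1 / 2) * (⟪x, p₂⟫_ℝ + ⟪x, p₃⟫_ℝ)) = (if t = 2 then 1 / 3 else 0) →
        ∃ (t : Fin 3) (s : ℝ), (s = 1 ∨ s = -1) ∧
          ∀ a, ⟪s • x, h a⟫_ℝ = if t = a then 1 / 3 else 0 := by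
      intro t s hs f₀ f₁ f₂
      refine ⟨t, s, hs, fun a => ?_⟩
      rw [real_inner_smul_left]
      fin_cases a
      · simpa only [Fin.zero_eta, Fin.mk_one, Fin.reduceFinMk, e₀, real_inner_smul_right,
          inner_add_right] using f₀
      · simpa only [Fin.zero_eta, Fin.mk_one, Fin.reduceFinMk, e₁, real_inner_smul_right,
          inner_add_right] using f₁
      · simpa only [Fin.zero_eta, Fin.mk_one, Fin.reduceFinMk, e₂, real_inner_smul_right,
          inner_add_right] using f₂
    have hthird : (0 : ℝ) ≤ 1 / 3 := by norm_num
    rcases (abs_eq hthird).1 a₁ with b₁ | b₁ <;> rcases (abs_eq hthird).1 a₂ with b₂ | b₂ <;>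
      rcases (abs_eq hthird).1 a₃ with b₃ | b₃ <;> rw [b₁, b₂, b₃] at hval hframe
    · exact Or.inl (Or.inr ((inner_eq_neg_one_iff_of_norm_eq_one hx hp).1 (by rw [hval]; norm_num)))
    · refine Or.inr (hframe 0 1 (Or.inl rfl) ?_ ?_ ?_) <;> norm_num [d₀₁, d₀₂]
    · refine Or.inr (hframe 1 1 (Or.inl rfl) ?_ ?_ ?_) <;> norm_num [d₀₁.symm, d₁₂]
    · refine Or.inr (hframe 2 1 (Or.inl rfl) ?_ ?_ ?_) <;> norm_num [d₀₂.symm, d₁₂.symm]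
    · refine Or.inr (hframe 2 (-1) (Or.inr rfl) ?_ ?_ ?_) <;> norm_num [d₀₂.symm, d₁₂.symm]
    · refine Or.inr (hframe 1 (-1) (Or.inr rfl) ?_ ?_ ?_) <;> norm_num [d₀₁.symm, d₁₂]
    · refine Or.inr (hframe 0 (-1) (Or.inr rfl) ?_ ?_ ?_) <;> norm_num [d₀₁, d₀₂]
    · exact Or.inl (Or.inl ((inner_eq_one_iff_of_norm_eq_one hx hp).1 (by rw [hval]; norm_num)))

/-- A subspace containing an orthonormal set `R` and three nonzero orthogonal vectors, orthogonal to
`R`, has dimension at least `R.card + 3`. -/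
theorem card_add_three_le_finrank {E : Type*} [NormedAddCommGroup E] [InnerProductSpace ℝ E]
    [FiniteDimensional ℝ E] (U : Submodule ℝ E) (R : Finset E) (h : Fin 3 → E)
    (hR : ∀ x ∈ R, ‖x‖ = 1) (horth : ∀ x ∈ R, ∀ y ∈ R, x ≠ y → ⟪x, y⟫_ℝ = 0)
    (hh : ∀ a b, ⟪h a, h b⟫_ℝ = if a = b then 1 / 3 else 0)
    (hRh : ∀ x ∈ R, ∀ a, ⟪x, h a⟫_ℝ = 0) (hRU : ∀ x ∈ R, x ∈ U) (hhU : ∀ a, h a ∈ U) :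
    R.card + 3 ≤ Module.finrank ℝ U := by
  have hli : LinearIndependent ℝ (Sum.elim (fun x : R => (x : E)) h) := by
    refine linearIndependent_of_ne_zero_of_inner_eq_zero (𝕜 := ℝ) ?_ ?_
    · rintro (x | a) h0
      · have := hR x x.2
        rw [Sum.elim_inl] at h0
        simp [h0] at this
      · have := hh a a
        rw [Sum.elim_inr] at h0
        simp [h0] at this
    · rintro (x | a) (y | b) hxy
      · exact horth x x.2 y y.2 fun h => hxy (congrArg Sum.inl (Subtype.ext h))
      · exact hRh x x.2 b
      · exact (real_inner_comm _ _).trans (hRh y y.2 a)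
      · exact (hh a b).trans (if_neg fun h => hxy (congrArg Sum.inr h))
  have h1 := finrank_span_eq_card hli
  rw [Fintype.card_sum, Fintype.card_coe, Fintype.card_fin] at h1
  rw [← h1]
  refine Submodule.finrank_mono (Submodule.span_le.2 ?_)
  rintro _ ⟨x | a, rfl⟩
  · exact hRU x x.2
  · exact hhU a

/-- Twenty-eight equiangular lines with angle `arccos (1/3)` and rank at most `14` have rank at
most `7`. -/
theorem finrank_span_le_seven {E : Type*} [NormedAddCommGroup E] [InnerProductSpace ℝ E]
    [FiniteDimensional ℝ E] (u : Fin 28 → E) (hu : ∀ i, ‖u i‖ = 1)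
    (hne : ∀ i j, i ≠ j → u i ≠ u j ∧ u i ≠ -u j) (hα : ∀ i j, i ≠ j → |⟪u i, u j⟫_ℝ| = 1 / 3)
    (hrank : Module.finrank ℝ (Submodule.span ℝ (Set.range u)) ≤ 14) :
    Module.finrank ℝ (Submodule.span ℝ (Set.range u)) ≤ 7 := by
  classical
  set U := Submodule.span ℝ (Set.range u) with hU
  have huU : ∀ i, u i ∈ U := fun i => Submodule.subset_span (Set.mem_range_self i)
  obtain ⟨i, j, k, hij, hik, hjk, hneg⟩ := exists_negative_triple u hu hα
    (by rw [Fintype.card_fin]; exact hrank.trans_lt (by norm_num))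
  have hval : ∀ a b, a ≠ b → ⟪u a, u b⟫_ℝ = 1 / 3 ∨ ⟪u a, u b⟫_ℝ = -(1 / 3) := fun a b hab =>
    (abs_eq (by norm_num)).1 (hα a b hab)
  -- Switch signs so that the triple has all inner products `-1/3`.
  obtain ⟨σ, τ, hσ, hτ, h12, h13, h23⟩ : ∃ σ τ : ℝ, (σ = 1 ∨ σ = -1) ∧ (τ = 1 ∨ τ = -1) ∧
      σ * ⟪u i, u j⟫_ℝ = -(1 / 3) ∧ τ * ⟪u i, u k⟫_ℝ = -(1 / 3) ∧
      σ * (τ * ⟪u j, u k⟫_ℝ) = -(1 / 3) := by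
    refine ⟨-3 * ⟪u i, u j⟫_ℝ, -3 * ⟪u i, u k⟫_ℝ, ?_⟩
    rcases hval i j hij with h1 | h1 <;> rcases hval i k hik with h2 | h2 <;>
      rcases hval j k hjk with h3 | h3 <;> rw [h1, h2, h3] at hneg <;>
      first | linarith | norm_num [h1, h2, h3]
  have hnorm : ∀ (s : ℝ) (l : Fin 28), (s = 1 ∨ s = -1) → ‖s • u l‖ = 1 := by
    rintro s l (rfl | rfl) <;> simp [hu]
  obtain ⟨h, p₄, hh, hhmem, hpmem, hclass⟩ := exists_orthogonal_frame_of_tetrahedron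
    (hu i) (hnorm σ j hσ) (hnorm τ k hτ) (by rw [real_inner_smul_right, h12])
    (by rw [real_inner_smul_right, h13])
    (by rw [real_inner_smul_left, real_inner_smul_right, h23])
  have hhU : ∀ a, h a ∈ U := fun a => by
    refine Submodule.span_le.2 ?_ (hhmem a)
    rintro _ (rfl | rfl | rfl)
    · exact huU i
    · exact U.smul_mem _ (huU j)
    · exact U.smul_mem _ (huU k)
  have hsmul : ∀ (s : ℝ) (l : Fin 28) (V : Submodule ℝ E), (s = 1 ∨ s = -1) → s • u l ∈ V →
      u l ∈ V := by
    rintro s l V (rfl | rfl) hV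
    · simpa using hV
    · simpa using hV
  set B : Finset (Fin 28) := {i, j, k} ∪ Finset.univ.filter (fun l => u l = p₄ ∨ u l = -p₄) with hB
  have hBcard : B.card ≤ 4 := by
    have h1 : (Finset.univ.filter (fun l => u l = p₄ ∨ u l = -p₄)).card ≤ 1 := by
      rw [Finset.card_le_one]
      intro a ha b hb
      by_contra hab
      have hn := hne a b hab
      rw [Finset.mem_filter] at ha hb
      rcases ha.2 with ha | ha <;> rcases hb.2 with hb | hb <;> simp [ha, hb] at hn
    have h2 : ({i, j, k} : Finset (Fin 28)).card ≤ 3 := Finset.card_le_three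
    exact (Finset.card_union_le _ _).trans (add_le_add h2 h1)
  have hBspan : ∀ l ∈ B, u l ∈ Submodule.span ℝ (Set.range h) := by
    intro l hl
    simp only [hB, Finset.mem_union, Finset.mem_insert, Finset.mem_singleton, Finset.mem_filter,
      Finset.mem_univ, true_and] at hl
    rcases hl with (rfl | rfl | rfl) | hl | hl
    · exact hpmem _ (by simp)
    · exact hsmul σ _ _ hσ (hpmem _ (by simp))
    · exact hsmul τ _ _ hτ (hpmem _ (by simp))
    · exact hl ▸ hpmem _ (by simp)
    · exact hl ▸ Submodule.neg_mem _ (hpmem _ (by simp))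
  have habs : ∀ (s : ℝ) (l m : Fin 28), (s = 1 ∨ s = -1) → l ≠ m →
      |⟪u l, s • u m⟫_ℝ| = 1 / 3 := by
    rintro s l m (rfl | rfl) hlm <;> simp [hα l m hlm, inner_neg_right]
  have hex : ∀ l, ∃ (t : Fin 3) (s : ℝ), l ∉ B → (s = 1 ∨ s = -1) ∧
      ∀ a, ⟪s • u l, h a⟫_ℝ = if t = a then 1 / 3 else 0 := by
    intro l
    by_cases hl : l ∈ B
    · exact ⟨0, 0, fun h => absurd hl h⟩
    · have hl' := hl
      simp only [hB, Finset.mem_union, Finset.mem_insert, Finset.mem_singleton, Finset.mem_filter,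
        Finset.mem_univ, true_and, not_or] at hl'
      obtain ⟨⟨hli, hlj, hlk⟩, hl4, hl4'⟩ := hl'
      rcases hclass (u l) (hu l) (hα l i hli) (habs σ l j hσ hlj) (habs τ l k hτ hlk) with
        (h4 | h4) | ⟨t, s, hs, hts⟩
      · exact absurd h4 hl4
      · exact absurd h4 hl4'
      · exact ⟨t, s, fun _ => ⟨hs, hts⟩⟩
  choose t s hts using hex
  let κ : ℝ := √(3 / 2)
  have hκ : κ * κ = 3 / 2 := Real.mul_self_sqrt (by norm_num)
  have hκ0 : κ ≠ 0 := by
    intro h0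
    rw [h0] at hκ
    norm_num at hκ
  let c : Fin 28 → E := fun l => κ • (s l • u l - h (t l))
  have hcin : ∀ l m, l ∉ B → m ∉ B →
      ⟪c l, c m⟫_ℝ = 3 / 2 * (⟪s l • u l, s m • u m⟫_ℝ - if t l = t m then 1 / 3 else 0) := by
    intro l m hl hm
    simp only [c]
    rw [real_inner_smul_left, real_inner_smul_right, ← mul_assoc, hκ, inner_sub_left,
      inner_sub_right, inner_sub_right, (hts l hl).2, hh,
      real_inner_comm (s m • u m) (h (t l)), (hts m hm).2]
    by_cases htt : t l = t m
    · simp only [htt, if_true]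
      ring
    · simp only [htt, Ne.symm htt, if_false]
      ring
  have hcunit : ∀ l, l ∉ B → ‖c l‖ = 1 := by
    intro l hl
    have h1 := hcin l l hl hl
    rw [real_inner_self_eq_norm_sq, real_inner_self_eq_norm_sq, hnorm (s l) l (hts l hl).1,
      if_pos rfl] at h1
    exact (pow_eq_one_iff_of_nonneg (norm_nonneg _) two_ne_zero).1 (by rw [h1]; norm_num)
  have hyval : ∀ l m, l ∉ B → m ∉ B → l ≠ m →
      ⟪s l • u l, s m • u m⟫_ℝ = 1 / 3 ∨ ⟪s l • u l, s m • u m⟫_ℝ = -(1 / 3) := by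
    intro l m hl hm hlm
    rw [real_inner_smul_left, real_inner_smul_right]
    rcases (hts l hl).1 with h1 | h1 <;> rcases (hts m hm).1 with h2 | h2 <;>
      rcases hval l m hlm with h3 | h3 <;> norm_num [h1, h2, h3]
  have hsame : ∀ l m, l ∉ B → m ∉ B → l ≠ m → t l = t m → ⟪c l, c m⟫_ℝ = 0 ∨ ⟪c l, c m⟫_ℝ = -1 := by
    intro l m hl hm hlm htt
    rw [hcin l m hl hm, if_pos htt]
    rcases hyval l m hl hm hlm with h3 | h3 <;> rw [h3] <;> norm_num
  have hch : ∀ l, l ∉ B → ∀ a, ⟪c l, h a⟫_ℝ = 0 := by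
    intro l hl a
    simp only [c]
    rw [real_inner_smul_left, inner_sub_left, (hts l hl).2, hh, sub_self, mul_zero]
  let I : Fin 3 → Finset (Fin 28) := fun a => Bᶜ.filter (fun l => t l = a)
  have hI : ∀ a l, l ∈ I a → l ∉ B ∧ t l = a := fun a l hl => by
    simpa only [I, Finset.mem_filter, Finset.mem_compl] using hl
  let C : Fin 3 → Finset E := fun a => (I a).image c
  have hC : ∀ a, ∀ x ∈ C a, ∃ l, (l ∉ B ∧ t l = a) ∧ c l = x := fun a x hx => by
    obtain ⟨l, hl, rfl⟩ := Finset.mem_image.1 hx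
    exact ⟨l, hI a l hl, rfl⟩
  have hinj : ∀ a, (C a).card = (I a).card := by
    intro a
    refine Finset.card_image_of_injOn fun l hl m hm hlm => ?_
    by_contra hne'
    obtain ⟨hlB, hlt⟩ := hI a l hl
    obtain ⟨hmB, hmt⟩ := hI a m hm
    have h1 := hsame l m hlB hmB hne' (hlt.trans hmt.symm)
    have hlm' : c l = c m := hlm
    rw [← hlm', real_inner_self_eq_norm_sq, hcunit l hlB] at h1
    norm_num at h1
  have hcard : 24 ≤ ∑ a, (C a).card := by
    have h1 : Bᶜ.card = ∑ a, (I a).card :=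
      Finset.card_eq_sum_card_fiberwise fun l _ => Finset.mem_coe.2 (Finset.mem_univ (t l))
    rw [Finset.card_compl, Fintype.card_fin] at h1
    simp only [hinj]
    omega
  rcases twelve_orthogonal_or_span_of_three_pillars C
    (fun a x hx => by
      obtain ⟨l, hl, rfl⟩ := hC a x hx
      exact hcunit l hl.1)
    (fun a x hx y hy hxy => by
      obtain ⟨l, hl, rfl⟩ := hC a x hx
      obtain ⟨m, hm, rfl⟩ := hC a y hy
      exact hsame l m hl.1 hm.1 (fun h => hxy (congrArg c h)) (hl.2.trans hm.2.symm))
    (fun a b hab x hx y hy => by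
      obtain ⟨l, hl, rfl⟩ := hC a x hx
      obtain ⟨m, hm, rfl⟩ := hC b y hy
      have htt : t l ≠ t m := by rw [hl.2, hm.2]; exact hab
      rw [hcin l m hl.1 hm.1, if_neg htt]
      rcases hyval l m hl.1 hm.1 (fun h => htt (congrArg t h)) with h3 | h3 <;> rw [h3] <;>
        norm_num [abs_of_neg])
    hcard with ⟨a, R, hRC, hRorth, hR12⟩ | ⟨R, hR4, hspan⟩
  · have h15 := card_add_three_le_finrank U R h
      (fun x hx => by
        obtain ⟨l, hl, rfl⟩ := hC a x (hRC hx)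
        exact hcunit l hl.1)
      hRorth hh
      (fun x hx => by
        obtain ⟨l, hl, rfl⟩ := hC a x (hRC hx)
        exact hch l hl.1)
      (fun x hx => by
        obtain ⟨l, hl, rfl⟩ := hC a x (hRC hx)
        exact U.smul_mem _ (U.sub_mem (U.smul_mem _ (huU l)) (hhU _)))
      hhU
    omega
  · set W := Submodule.span ℝ ((R ∪ Finset.univ.image h : Finset E) : Set E) with hW
    have hRW : Submodule.span ℝ (R : Set E) ≤ W :=
      Submodule.span_mono (by exact_mod_cast Finset.subset_union_left)
    have hhW : Submodule.span ℝ (Set.range h) ≤ W :=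
      Submodule.span_mono (by simp)
    have hUW : U ≤ W := by
      refine Submodule.span_le.2 ?_
      rintro _ ⟨l, rfl⟩
      by_cases hl : l ∈ B
      · exact hhW (hBspan l hl)
      · have h1 : c l ∈ W := hRW (hspan (t l) (c l) (Finset.mem_image_of_mem c
          (Finset.mem_filter.2 ⟨Finset.mem_compl.2 hl, rfl⟩)))
        have h2 : s l • u l - h (t l) ∈ W := (W.smul_mem_iff hκ0).1 h1
        have h3 : h (t l) ∈ W := hhW (Submodule.subset_span (Set.mem_range_self _))
        exact hsmul (s l) l W (hts l hl).1 (by simpa using W.add_mem h2 h3)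
    have h1 := Submodule.finrank_mono hUW
    have h2 : Module.finrank ℝ W ≤ (R ∪ Finset.univ.image h).card := finrank_span_finset_le_card _
    have h3 := Finset.card_union_le R (Finset.univ.image h)
    have h4 : (Finset.univ.image h).card ≤ 3 := Finset.card_image_le
    omega

/-- Proposition 2.3 (3). For `8 ≤ n ≤ 13` there is no equiangular
family of `28` lines spanning an `n`-dimensional subspace of a Euclidean space:
there are no unit vectors `u₁, …, u₂₈`, pairwise non-proportional, whose pairwise
inner products have constant absolute value and whose span has dimension `n`. -/
theorem no_28_equiangular_lines_rank_8_to_13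
    {E : Type*} [NormedAddCommGroup E] [InnerProductSpace ℝ E] [FiniteDimensional ℝ E]
    (n : ℕ) (h8 : 8 ≤ n) (h13 : n ≤ 13) :
    ¬ ∃ (u : Fin 28 → E) (α : ℝ),
        (∀ i, ‖u i‖ = 1) ∧
        (∀ i j, i ≠ j → u i ≠ u j ∧ u i ≠ -u j) ∧
        (∀ i j, i ≠ j → |⟪u i, u j⟫_ℝ| = α) ∧
        Module.finrank ℝ (Submodule.span ℝ (Set.range u)) = n := by
  rintro ⟨u, α, hu, hne, hα, hrank⟩
  obtain rfl := equiangular_constant_eq_third u hu hne hα (by omega)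
  have := finrank_span_le_seven u hu hne hα (by omega)
  omega
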